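/- arXiv:1707.07293 — 3 statements merged into one kernel-verified Lean document; each statement's English description precedes it below -/
import Mathlib

section
/- If N is a normal subgroup of a finite group G and α(G) = α(G/N), then N is an elementary abelian 2-group. -/
open scoped Classical

/-- The number of cyclic subgroups of a group. -/
noncomputable def numCyclic (G : Type*) [Group G] : ℕ :=
  Nat.card {H : Subgroup G // IsCyclic (↥H)}

/-- `alpha G = c(G) / |G|`, the number of cyclic subgroups divided by the order. -/
noncomputable def alpha (G : Type*) [Group G] : ℚ :=
  (numCyclic G : ℚ) / (Nat.card G : ℚ)

/-- A cyclic subgroup `H` is generated by exactly `φ(|H|)` elements. -/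
lemma card_zpowers_eq_subgroup {G : Type*} [Group G] [Fintype G] (H : Subgroup G)
    [IsCyclic H] :
    (Finset.univ.filter fun x : G => Subgroup.zpowers x = H).card
      = Nat.totient (Nat.card H) := by
  have e := IsCyclic.card_orderOf_eq_totient (α := H) (d := Nat.card H)
    (by rw [Nat.card_eq_fintype_card])
  rw [← e]
  symm
  refine Finset.card_bij (fun a _ => (a : G)) ?_ (fun _ _ _ _ h => Subtype.ext h) ?_
  · intro a ha
    simp only [Finset.mem_filter, Finset.mem_univ, true_and] at ha ⊢
    refine Subgroup.eq_of_le_of_card_ge (by simp) ?_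
    rw [Nat.card_zpowers, Subgroup.orderOf_coe, ha]
  · intro b hb
    simp only [Finset.mem_filter, Finset.mem_univ, true_and] at hb
    refine ⟨⟨b, hb ▸ Subgroup.mem_zpowers b⟩, ?_, rfl⟩
    simp only [Finset.mem_filter, Finset.mem_univ, true_and]
    rw [Subgroup.orderOf_mk, ← Nat.card_zpowers, hb]

/-- The number of cyclic subgroups is the sum of `1 / φ(o(x))` over all elements `x`. -/
lemma numCyclic_eq_sum (G : Type*) [Group G] [Fintype G] :
    (numCyclic G : ℚ) = ∑ x : G, ((Nat.totient (orderOf x) : ℚ))⁻¹ := by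
  let g : G → {H : Subgroup G // IsCyclic H} := fun x => ⟨Subgroup.zpowers x, inferInstance⟩
  rw [← Finset.sum_fiberwise Finset.univ g]
  have key (H : {H : Subgroup G // IsCyclic H}) :
      ∑ x with g x = H, ((Nat.totient (orderOf x) : ℚ))⁻¹ = 1 := by
    obtain ⟨H, hH⟩ := H
    have h₁ : ∀ x ∈ Finset.univ.filter (fun x => g x = ⟨H, hH⟩),
        ((Nat.totient (orderOf x) : ℚ))⁻¹ = ((Nat.totient (Nat.card H) : ℚ))⁻¹ := by
      intro x hx
      simp only [g, Finset.mem_filter, Finset.mem_univ, true_and, Subtype.mk.injEq] at hx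
      rw [← Nat.card_zpowers, hx]
    have hpos : 0 < Nat.totient (Nat.card H) := Nat.totient_pos.2 Nat.card_pos
    rw [Finset.sum_congr rfl h₁, Finset.sum_const, nsmul_eq_mul]
    simp only [g, Subtype.mk.injEq]
    rw [card_zpowers_eq_subgroup H]
    exact mul_inv_cancel₀ (by exact_mod_cast hpos.ne')
  simp only [key, numCyclic, Nat.card_eq_fintype_card, Finset.sum_const, Finset.card_univ,
    nsmul_eq_mul, mul_one]

/-- Summing a function on `G ⧸ N` over `G` multiplies the sum by `|N|`. -/
lemma sum_quotient_mk {G : Type*} [Group G] [Fintype G] (N : Subgroup G) (f : G ⧸ N → ℚ) :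
    ∑ x : G, f x = Nat.card N * ∑ q : G ⧸ N, f q := by
  rw [← Finset.sum_fiberwise' Finset.univ (fun x : G => (x : G ⧸ N)) f, Finset.mul_sum]
  refine Finset.sum_congr rfl fun q _ => ?_
  rw [Finset.sum_const, nsmul_eq_mul]
  have := QuotientGroup.card_preimage_mk N {q}
  rw [Nat.card_unique (α := ({q} : Set (G ⧸ N))), mul_one] at this
  rw [← this, Nat.card_eq_fintype_card, Fintype.card_subtype]
  simp

theorem stmt_4 (G : Type*) [Group G] [Fintype G] (N : Subgroup G) [N.Normal]
    (h : alpha G = alpha (G ⧸ N)) :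
    ∀ n ∈ N, n ^ 2 = 1 := by
  have hN : (Nat.card N : ℚ) ≠ 0 := by exact_mod_cast Nat.card_pos.ne'
  have hQ : (Nat.card (G ⧸ N) : ℚ) ≠ 0 := by exact_mod_cast Nat.card_pos.ne'
  have hG : (Nat.card G : ℚ) = Nat.card (G ⧸ N) * Nat.card N := by
    exact_mod_cast Subgroup.card_eq_card_quotient_mul_card_subgroup N
  have hc : (numCyclic G : ℚ) = Nat.card N * numCyclic (G ⧸ N) := by
    rw [alpha, alpha, hG] at h
    field_simp at h
    linarith
  rw [numCyclic_eq_sum, numCyclic_eq_sum, ← sum_quotient_mk] at hc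
  have hle : ∀ x ∈ (Finset.univ : Finset G), ((Nat.totient (orderOf x) : ℚ))⁻¹ ≤
      ((Nat.totient (orderOf (x : G ⧸ N)) : ℚ))⁻¹ := by
    intro x _
    have hpos : 0 < Nat.totient (orderOf (x : G ⧸ N)) := Nat.totient_pos.2 (orderOf_pos _)
    have hdvd := Nat.totient_dvd_of_dvd (orderOf_map_dvd (QuotientGroup.mk' N) x)
    have hle := Nat.le_of_dvd (Nat.totient_pos.2 (orderOf_pos x)) hdvd
    exact inv_anti₀ (by exact_mod_cast hpos) (by exact_mod_cast hle)
  intro n hn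
  have heq := (Finset.sum_eq_sum_iff_of_le hle).1 hc n (Finset.mem_univ n)
  rw [(QuotientGroup.eq_one_iff n).2 hn, orderOf_one, Nat.totient_one, inv_inj] at heq
  rcases Nat.totient_eq_one_iff.1 (by exact_mod_cast heq) with h₁ | h₂
  · rw [orderOf_eq_one_iff.1 h₁, one_pow]
  · rw [← h₂, pow_orderOf_eq_one]
end

section
/- Let G be a finite group with normal subgroups L and N such that L ⊆ N. If α(G) = α(G/N), then α(G) = α(G/L). -/
open scoped Classical

/-- A finite cyclic subgroup has as many generators as the totient of its order. -/
theorem card_filter_zpowers_eq {G : Type*} [Group G] [Fintype G] (H : Subgroup G)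
    [IsCyclic H] : (Finset.univ.filter fun g : G => Subgroup.zpowers g = H).card =
      Nat.totient (Nat.card H) := by
  rw [Nat.card_eq_fintype_card, ← IsCyclic.card_orderOf_eq_totient (α := H) dvd_rfl,
    ← Finset.card_map (Function.Embedding.subtype (· ∈ H))]
  congr 1
  ext g
  simp only [Finset.mem_filter, Finset.mem_univ, true_and, Finset.mem_map,
    Function.Embedding.subtype_apply, Subtype.exists, exists_and_right, exists_eq_right,
    Subgroup.orderOf_mk, ← Nat.card_eq_fintype_card]
  refine ⟨?_, fun ⟨hg, hcard⟩ => ?_⟩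
  · rintro rfl
    exact ⟨Subgroup.mem_zpowers g, (Nat.card_zpowers g).symm⟩
  · exact Subgroup.eq_of_le_of_card_ge (by simpa using hg)
      (by rw [Nat.card_zpowers, hcard])

theorem numCyclic_eq_sum_inv_totient (G : Type*) [Group G] [Fintype G] :
    (numCyclic G : ℚ) = ∑ g : G, ((Nat.totient (orderOf g) : ℚ))⁻¹ := by
  let f : G → {H : Subgroup G // IsCyclic H} := fun g => ⟨Subgroup.zpowers g, inferInstance⟩
  rw [numCyclic, Nat.card_eq_fintype_card, ← Finset.sum_fiberwise Finset.univ f,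
    ← Finset.card_univ, Finset.card_eq_sum_ones, Nat.cast_sum]
  refine Finset.sum_congr rfl fun ⟨H, hH⟩ _ => ?_
  have hsum : ∀ g ∈ Finset.univ.filter (fun g => f g = ⟨H, hH⟩),
      ((Nat.totient (orderOf g) : ℚ))⁻¹ = ((Nat.totient (Nat.card H) : ℚ))⁻¹ := by
    intro g hg
    have hgH : Subgroup.zpowers g = H := by simpa [f] using hg
    rw [← hgH, Nat.card_zpowers]
  have hcard : (Finset.univ.filter fun g => f g = ⟨H, hH⟩).card = Nat.totient (Nat.card H) := by
    rw [← card_filter_zpowers_eq H]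
    simp [f]
  have hpos : (Nat.totient (Nat.card H) : ℚ) ≠ 0 := by
    exact_mod_cast (Nat.totient_pos.2 Nat.card_pos).ne'
  rw [Finset.sum_congr rfl hsum, Finset.sum_const, hcard, nsmul_eq_mul, mul_inv_cancel₀ hpos,
    Nat.cast_one]

/-- Averaging a function over a finite group after a surjective homomorphism agrees with
averaging it over the target. -/
theorem sum_comp_div_card_of_surjective {G H : Type*} [Group G] [Group H] [Fintype G] [Fintype H]
    (f : G →* H) (hf : Function.Surjective f) (w : H → ℚ) :
    (∑ g, w (f g)) / Nat.card G = (∑ h, w h) / Nat.card H := by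
  set k := (Finset.univ.filter fun g => f g = 1).card with hk
  have hfiber (h : H) : (Finset.univ.filter fun g => f g = h).card = k :=
    MonoidHom.card_fiber_eq_of_mem_range f (hf h) (hf 1)
  have hsum (v : H → ℚ) : ∑ g, v (f g) = k * ∑ h, v h := by
    rw [← Finset.sum_fiberwise' Finset.univ f v, Finset.mul_sum]
    exact Finset.sum_congr rfl fun h _ => by rw [Finset.sum_const, hfiber, nsmul_eq_mul]
  have hcard : (Nat.card G : ℚ) = k * Nat.card H := by simpa using hsum fun _ => 1
  have hk0 : (k : ℚ) ≠ 0 := by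
    have : (Nat.card G : ℚ) ≠ 0 := by exact_mod_cast Nat.card_pos.ne'
    exact left_ne_zero_of_mul (hcard ▸ this)
  rw [hsum, hcard, mul_div_mul_left _ _ hk0]

theorem alpha_le_of_surjective {G H : Type*} [Group G] [Group H] [Finite G]
    (f : G →* H) (hf : Function.Surjective f) : alpha G ≤ alpha H := by
  have := Fintype.ofFinite G
  have := Fintype.ofSurjective f hf
  rw [alpha, alpha, numCyclic_eq_sum_inv_totient, numCyclic_eq_sum_inv_totient,
    ← sum_comp_div_card_of_surjective f hf]
  gcongr with g
  · exact_mod_cast Nat.totient_pos.2 (orderOf_pos (f g))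
  · exact Nat.le_of_dvd (Nat.totient_pos.2 (orderOf_pos g))
      (Nat.totient_dvd_of_dvd (orderOf_map_dvd f g))

theorem stmt_6 (G : Type*) [Group G] [Fintype G] (L N : Subgroup G)
    [L.Normal] [N.Normal] (hLN : L ≤ N) (h : alpha G = alpha (G ⧸ N)) :
    alpha G = alpha (G ⧸ L) := by
  refine le_antisymm (alpha_le_of_surjective _ (QuotientGroup.mk'_surjective L)) ?_
  rw [h]
  exact alpha_le_of_surjective (QuotientGroup.map L N (MonoidHom.id G) hLN)
    (QuotientGroup.map_surjective_of_surjective L N (MonoidHom.id G)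
      (QuotientGroup.mk'_surjective N) hLN)
end

section
/- If G is a finite group with α(G) ≥ 1/2, then cp(G) ≥ (2α(G) − 1)². -/
open scoped Classical

/-- Each cyclic subgroup with a generator `g` contributes the elements `g` and `g⁻¹`, where an
involution or the identity is counted twice. -/
lemma two_mul_numCyclic_le (G : Type*) [Group G] [Finite G] :
    2 * numCyclic G ≤ Nat.card G + Nat.card {g : G // g * g = 1} := by
  have hgen : ∀ H : {H : Subgroup G // IsCyclic H}, ∃ g : G, Subgroup.zpowers g = H := fun H =>
    (Subgroup.isCyclic_iff_exists_zpowers_eq_top H.1).1 H.2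
  choose γ hγ using hgen
  have hγi : ∀ {H K}, γ H = γ K → H = K := fun {H K} e =>
    Subtype.ext (by rw [← hγ H, ← hγ K, e])
  have hγi' : ∀ {H K}, (γ H)⁻¹ = γ K → H = K := fun {H K} e =>
    Subtype.ext (by rw [← hγ H, ← hγ K, ← e, Subgroup.zpowers_inv])
  let f : {H : Subgroup G // IsCyclic H} ⊕ {H : Subgroup G // IsCyclic H} →
      G ⊕ {g : G // g * g = 1} :=
    Sum.elim (fun H => Sum.inl (γ H))
      (fun H => if h : γ H * γ H = 1 then Sum.inr ⟨γ H, h⟩ else Sum.inl (γ H)⁻¹)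
  have hf : Function.Injective f := by
    have hmix : ∀ H K, f (Sum.inl H) ≠ f (Sum.inr K) := by
      intro H K e
      simp only [f, Sum.elim_inl, Sum.elim_inr] at e
      split_ifs at e with h
      have e' := Sum.inl.inj e
      obtain rfl := hγi' e'.symm
      exact h (mul_eq_one_iff_eq_inv.2 e')
    rintro (H | H) (K | K) e
    · exact congrArg _ (hγi (Sum.inl.inj e))
    · exact (hmix _ _ e).elim
    · exact (hmix _ _ e.symm).elim
    · simp only [f, Sum.elim_inr] at e
      split_ifs at e
      · exact congrArg _ (hγi (congrArg Subtype.val (Sum.inr.inj e)))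
      · exact congrArg _ (hγi (inv_injective (Sum.inl.inj e)))
  have := Nat.card_le_card_of_injective f hf
  rwa [Nat.card_sum, Nat.card_sum, ← two_mul] at this

/-- If `a * a = b * b = 1`, then `a` conjugates `a * b` to its inverse, so `a` lies in a fixed
coset of the centralizer of `a * b`. -/
lemma sq_card_mul_self_eq_one_le (G : Type*) [Group G] [Finite G] :
    Nat.card {g : G // g * g = 1} ^ 2 ≤ Nat.card (ConjClasses G) * Nat.card G := by
  have hinv : ∀ g : G, ∃ t : G, (∃ s : G, s * g * s⁻¹ = g⁻¹) → t * g * t⁻¹ = g⁻¹ := fun g => by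
    by_cases h : ∃ s : G, s * g * s⁻¹ = g⁻¹
    · exact ⟨h.choose, fun _ => h.choose_spec⟩
    · exact ⟨1, fun h' => (h h').elim⟩
  choose t ht using hinv
  have hconj : ∀ p : {g : G // g * g = 1} × {g : G // g * g = 1},
      p.1.1 * (p.1.1 * p.2.1) * p.1.1⁻¹ = (p.1.1 * p.2.1)⁻¹ := by
    rintro ⟨⟨a, ha⟩, ⟨b, hb⟩⟩
    have hb' : b⁻¹ = b := inv_eq_of_mul_eq_one_left hb
    simp only [mul_inv_rev, ← mul_assoc, ha, one_mul, hb']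
  let f : {g : G // g * g = 1} × {g : G // g * g = 1} → {p : G × G // Commute p.1 p.2} :=
    fun p => ⟨((t (p.1.1 * p.2.1))⁻¹ * p.1.1, p.1.1 * p.2.1), by
      have h₁ := hconj p
      have h₂ := ht _ ⟨_, h₁⟩
      generalize p.1.1 * p.2.1 = g at h₁ h₂ ⊢
      rw [← h₂, mul_inv_eq_iff_eq_mul] at h₁
      change (t g)⁻¹ * p.1.1 * g = g * ((t g)⁻¹ * p.1.1)
      rw [mul_assoc, h₁]
      group⟩
  have hf : Function.Injective f := by
    intro p q e
    obtain ⟨e₁, e₂⟩ := Prod.ext_iff.1 (congrArg Subtype.val e)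
    simp only [f] at e₁ e₂
    rw [e₂, mul_right_inj] at e₁
    rw [e₁, mul_right_inj] at e₂
    exact Prod.ext (Subtype.ext e₁) (Subtype.ext e₂)
  have := Nat.card_le_card_of_injective f hf
  rwa [Nat.card_prod, ← sq, card_comm_eq_card_conjClasses_mul_card] at this

theorem stmt_13 (G : Type*) [Group G] [Fintype G] (h : alpha G ≥ 1 / 2) :
    (Nat.card (ConjClasses G) : ℚ) / (Nat.card G : ℚ) ≥ (2 * alpha G - 1) ^ 2 := by
  have hn : (0 : ℚ) < Nat.card G := by exact_mod_cast Nat.card_pos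
  have h₁ : (2 * numCyclic G : ℚ) ≤ Nat.card G + Nat.card {g : G // g * g = 1} := by
    exact_mod_cast two_mul_numCyclic_le G
  have h₂ : (Nat.card {g : G // g * g = 1} : ℚ) ^ 2 ≤
      Nat.card (ConjClasses G) * Nat.card G := by
    exact_mod_cast sq_card_mul_self_eq_one_le G
  have h₃ : 2 * alpha G - 1 ≤ Nat.card {g : G // g * g = 1} / (Nat.card G : ℚ) := by
    rw [alpha, le_div_iff₀ hn, sub_mul, mul_assoc, div_mul_cancel₀ _ hn.ne']
    linarith
  calc (2 * alpha G - 1) ^ 2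
      ≤ (Nat.card {g : G // g * g = 1} / (Nat.card G : ℚ)) ^ 2 :=
        pow_le_pow_left₀ (by linarith) h₃ 2
    _ ≤ Nat.card (ConjClasses G) / (Nat.card G : ℚ) := by
        rw [div_pow, div_le_div_iff₀ (by positivity) hn, sq (Nat.card G : ℚ), ← mul_assoc]
        exact mul_le_mul_of_nonneg_right h₂ hn.le
end
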